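/- Let c ∈ 𝕋 with c ≠ 0 and let μ be a g-measure for g^c satisfying μ(⟨ω⟩) > 0 for every finite binary word ω. Then liminf_{n→∞} (1/n²)·min_{ω∈{0,1}^n} log μ(⟨ω⟩) ≥ −1. -/

import Mathlib

open MeasureTheory Filter Topology Set
open scoped ENNReal

noncomputable section

namespace GTM

abbrev Torus := AddCircle (1 : ℝ)

instance : Fact ((0:ℝ) < 1) := ⟨one_pos⟩

/-- The doubling map on the torus. -/
def dbl (x : Torus) : Torus := x + x

/-- The function `x ↦ |cos (π x)|` lifted to the torus. -/
def absCos : Torus → ℝ :=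
  Function.Periodic.lift (f := fun x : ℝ => |Real.cos (Real.pi * x)|)
    (by
      intro x
      simp [mul_add, mul_one, Real.cos_add_pi, abs_neg])

/-- The potential `ψ^c(x) = 2 log |cos (π (x - c))|`, with value `⊥ = -∞` at the
singularity `c + 1/2`. -/
def psi (c : Torus) (x : Torus) : EReal :=
  if absCos (x - c) = 0 then ⊥ else ((2 * Real.log (absCos (x - c)) : ℝ) : EReal)

/-- The Birkhoff sums `ψ^c_n` of the potential `ψ^c` under the doubling map. -/
def psiSum (c : Torus) (n : ℕ) (x : Torus) : EReal :=
  ∑ k ∈ Finset.range n, psi c (dbl^[k] x)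

/-- The left endpoint of the dyadic cylinder interval of a binary word. -/
def wordVal (n : ℕ) (ω : Fin n → Bool) : ℝ :=
  ∑ i : Fin n, (if ω i then (1 : ℝ) else 0) / 2 ^ ((i : ℕ) + 1)

/-- The closed dyadic interval `⟨ω⟩ ⊆ 𝕋` associated to a binary word `ω`. -/
def cyl (n : ℕ) (ω : Fin n → Bool) : Set Torus :=
  (fun x : ℝ => (x : Torus)) '' Set.Icc (wordVal n ω) (wordVal n ω + 1 / 2 ^ n)

/-- The exponential function on extended reals, `exp ⊥ = 0`, `exp ⊤ = ∞`. -/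
def eexp (x : EReal) : ℝ≥0∞ :=
  if x = ⊥ then 0 else if x = ⊤ then ⊤ else ENNReal.ofReal (Real.exp x.toReal)

/-- The logarithm on `ℝ≥0∞`, `log 0 = ⊥`, `log ∞ = ⊤`. -/
def elog (x : ℝ≥0∞) : EReal :=
  if x = 0 then ⊥ else if x = ⊤ then ⊤ else ((Real.log x.toReal : ℝ) : EReal)

/-- The partition function `Σ_{ω ∈ {0,1}ⁿ} exp (t · sup_{x ∈ ⟨ω⟩} ψ^c_n(x))`. -/
def presZ (c : Torus) (t : ℝ) (n : ℕ) : ℝ≥0∞ :=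
  ∑ ω : Fin n → Bool, eexp ((t : EReal) * ⨆ x ∈ cyl n ω, psiSum c n x)

/-- The upper topological pressure `P̄_top(t ψ^c)`. -/
def presUpper (c : Torus) (t : ℝ) : EReal :=
  atTop.limsup fun n : ℕ => (((n : ℝ)⁻¹ : ℝ) : EReal) * elog (presZ c t n)

/-- The lower topological pressure `P̲_top(t ψ^c)`. -/
def presLower (c : Torus) (t : ℝ) : EReal :=
  atTop.liminf fun n : ℕ => (((n : ℝ)⁻¹ : ℝ) : EReal) * elog (presZ c t n)

/-- The `g`-function `g^c(x) = cos² (π (x - c))`. -/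
def gfun (c : Torus) (x : Torus) : ℝ := (absCos (x - c)) ^ 2

/-- The halving map `x ↦ x/2` on the torus, computed on the representative in `[0,1)`. -/
def half (x : Torus) : Torus := (((AddCircle.equivIco 1 0 x : ℝ) / 2 : ℝ) : Torus)

/-- `μ` is a `g`-measure for `g^c`: it is a Borel probability measure invariant under the
dual transfer operator of `g^c`. -/
def IsGMeasure (c : Torus) (μ : Measure Torus) : Prop :=
  IsProbabilityMeasure μ ∧
    ∀ f : C(Torus, ℝ),
      ∫ x, f x ∂μ =
        ∫ x,
          (gfun c (half x) * f (half x) +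
            gfun c (half x + (((1 : ℝ) / 2 : ℝ) : Torus)) *
              f (half x + (((1 : ℝ) / 2 : ℝ) : Torus))) ∂μ

/-- The closed arc of the torus starting at `x`, of length `δ`. -/
def arc (x δ : ℝ) : Set Torus := (fun y : ℝ => (y : Torus)) '' Set.Icc x (x + δ)

lemma isCompact_arc (x δ : ℝ) : IsCompact (arc x δ) :=
  isCompact_Icc.image (AddCircle.continuous_mk' 1)

lemma arc_add_intCast (x δ : ℝ) (m : ℤ) : arc (x + m) δ = arc x δ := by
  have h : ∀ y : ℝ, ((y + m : ℝ) : Torus) = y := fun y => by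
    have h1 : ((m : ℝ) : Torus) = 0 := by
      rw [AddCircle.coe_eq_zero_iff]
      exact ⟨m, by simp⟩
    rw [AddCircle.coe_add, h1, add_zero]
  ext z
  constructor
  · rintro ⟨y, ⟨h1, h2⟩, rfl⟩
    refine ⟨y - m, ⟨by linarith, by linarith⟩, ?_⟩
    have := h (y - m)
    simp only [sub_add_cancel] at this
    exact this.symm
  · rintro ⟨y, ⟨h1, h2⟩, rfl⟩
    exact ⟨y + m, ⟨by linarith, by linarith⟩, h y⟩

lemma dbl_image_arc (x δ : ℝ) : dbl '' arc x δ = arc (2 * x) (2 * δ) := by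
  ext z
  constructor
  · rintro ⟨_, ⟨y, ⟨h1, h2⟩, rfl⟩, rfl⟩
    refine ⟨y + y, ⟨by linarith, by linarith⟩, ?_⟩
    simp [dbl]
  · rintro ⟨y, ⟨h1, h2⟩, rfl⟩
    refine ⟨_, ⟨y / 2, ⟨by linarith, by linarith⟩, rfl⟩, ?_⟩
    change ((y / 2 : ℝ) : Torus) + ((y / 2 : ℝ) : Torus) = y
    rw [← AddCircle.coe_add, add_halves]

lemma half_add_half (x : Torus) : half x + half x = x := by
  rw [half, ← AddCircle.coe_add, add_halves, AddCircle.coe_equivIco]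

lemma eq_half_or_eq_half_add {x y : Torus} (h : y + y = x) :
    y = half x ∨ y = half x + (((1 : ℝ) / 2 : ℝ) : Torus) := by
  obtain ⟨t, rfl⟩ := QuotientAddGroup.mk_surjective y
  set s : ℝ := (AddCircle.equivIco 1 0 x : ℝ) / 2 with hs
  have hx : half x = ((s : ℝ) : Torus) := rfl
  have h2 : ((t + t - (s + s) : ℝ) : Torus) = 0 := by
    rw [AddCircle.coe_sub, sub_eq_zero, AddCircle.coe_add, AddCircle.coe_add, ← hx,
      half_add_half]
    exact h
  obtain ⟨m, hm⟩ := (AddCircle.coe_eq_zero_iff (1 : ℝ)).1 h2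
  have hm' : (m : ℝ) = t + t - (s + s) := by simpa using hm
  rw [hx]
  rcases Int.even_or_odd' m with ⟨k, hk | hk⟩
  · left
    change ((t : ℝ) : Torus) = s
    rw [← sub_eq_zero, ← AddCircle.coe_sub, AddCircle.coe_eq_zero_iff]
    refine ⟨k, ?_⟩
    rw [hk] at hm'
    push_cast at hm'
    simp only [zsmul_eq_mul, mul_one]
    linarith
  · right
    change ((t : ℝ) : Torus) = _
    rw [← AddCircle.coe_add, ← sub_eq_zero, ← AddCircle.coe_sub, AddCircle.coe_eq_zero_iff]
    refine ⟨k, ?_⟩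
    rw [hk] at hm'
    push_cast at hm'
    simp only [zsmul_eq_mul, mul_one]
    linarith

lemma absCos_coe (x : ℝ) : absCos (x : Torus) = |Real.cos (Real.pi * x)| := rfl

lemma continuous_absCos : Continuous absCos := by
  refine continuous_coinduced_dom.2 ?_
  change Continuous fun x : ℝ => |Real.cos (Real.pi * x)|
  fun_prop

lemma continuous_gfun (c : Torus) : Continuous (gfun c) :=
  (continuous_absCos.comp (continuous_id.sub continuous_const)).pow 2

lemma gfun_nonneg (c x : Torus) : 0 ≤ gfun c x := sq_nonneg _

lemma gfun_le_one (c x : Torus) : gfun c x ≤ 1 := by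
  obtain ⟨t, ht⟩ := QuotientAddGroup.mk_surjective (x - c)
  rw [gfun, ← ht]
  rw [absCos_coe, sq_abs]
  exact Real.cos_sq_le_one _

lemma measurable_half : Measurable half := by
  have h : Measurable fun x : Torus => (AddCircle.equivIco 1 0 x : ℝ) :=
    measurable_subtype_coe.comp (AddCircle.measurableEquivIco (1 : ℝ) 0).measurable
  exact (AddCircle.continuous_mk' 1).measurable.comp (h.div_const 2)

/-- A lower bound for the `g`-function on a compact set compares the measure of that set with the
measure of its image under the doubling map. -/
lemma IsGMeasure.mul_measureReal_dbl_image_le {c : Torus} {μ : Measure Torus}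
    (hμ : IsGMeasure c μ) {A : Set Torus} (hA : IsCompact A) {κ : ℝ}
    (hg : ∀ y ∈ A, κ ≤ gfun c y) : κ * μ.real (dbl '' A) ≤ μ.real A := by
  obtain ⟨hprob, hinv⟩ := hμ
  refine le_of_forall_pos_le_add fun ε hε => ?_
  obtain ⟨U, hAU, hU, hUε⟩ := A.exists_isOpen_lt_add (μ := μ) (measure_ne_top μ A)
    (ε := ENNReal.ofReal ε) (by simpa using hε)
  obtain ⟨f, hf0, hf1, hf⟩ := exists_continuous_zero_one_of_isClosed hU.isClosed_compl
    hA.isClosed (disjoint_compl_left_iff_subset.2 hAU)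
  have hfU : ∫ x, f x ∂μ ≤ μ.real U := by
    rw [← integral_indicator_one hU.measurableSet]
    refine integral_mono (f.continuous.integrable_of_hasCompactSupport
      (HasCompactSupport.of_compactSpace _))
      ((integrable_const (1 : ℝ)).indicator hU.measurableSet) fun x => ?_
    by_cases hx : x ∈ U
    · simpa [hx] using (hf x).2
    · simp [hx, hf0 hx]
  have hUA : μ.real U ≤ μ.real A + ε := by
    have := ENNReal.toReal_mono (by finiteness) hUε.le
    rwa [ENNReal.toReal_add (by finiteness) (by finiteness), ENNReal.toReal_ofReal hε.le] at this
  refine le_trans ?_ (hfU.trans hUA)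
  have hTA : MeasurableSet (dbl '' A) :=
    (hA.image (continuous_id.add continuous_id)).measurableSet
  have hbranch : ∀ b : Torus, Measurable fun x => gfun c (half x + b) * f (half x + b) := fun b =>
    (((continuous_gfun c).mul f.continuous).measurable).comp (measurable_half.add_const b)
  have hbd : ∀ y, 0 ≤ gfun c y * f y ∧ gfun c y * f y ≤ 1 := fun y =>
    ⟨mul_nonneg (gfun_nonneg c y) (hf y).1, mul_le_one₀ (gfun_le_one c y) (hf y).1 (hf y).2⟩
  rw [hinv f, mul_comm, ← smul_eq_mul, ← integral_indicator_const _ hTA]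
  refine integral_mono ((integrable_const κ).indicator hTA) ?_ fun x => ?_
  · refine Integrable.of_bound
      (Measurable.aestronglyMeasurable (by simpa using (hbranch 0).fun_add (hbranch _))) 2
      (Eventually.of_forall fun x => ?_)
    have h1 := hbd (half x)
    have h2 := hbd (half x + (((1 : ℝ) / 2 : ℝ) : Torus))
    rw [Real.norm_of_nonneg (add_nonneg h1.1 h2.1)]
    linarith [h1.2, h2.2]
  · have h1 := (hbd (half x)).1
    have h2 := (hbd (half x + (((1 : ℝ) / 2 : ℝ) : Torus))).1
    by_cases hx : x ∈ dbl '' A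
    · obtain ⟨y, hy, hyx⟩ := hx
      have hval : κ ≤ gfun c y * f y := by simpa [hf1 hy] using hg y hy
      rw [Set.indicator_of_mem (Set.mem_image_of_mem dbl hy |> hyx.subst)]
      rcases eq_half_or_eq_half_add hyx with h | h
      · rw [h] at hval
        change κ ≤ _ + _
        linarith
      · rw [h] at hval
        change κ ≤ _ + _
        linarith
    · rw [Set.indicator_of_notMem hx]
      exact add_nonneg h1 h2

lemma IsGMeasure.prod_mul_measureReal_arc_le {c : Torus} {μ : Measure Torus}
    (hμ : IsGMeasure c μ) (x δ : ℝ) (κ : ℕ → ℝ) (hκ : ∀ k, 0 ≤ κ k) (n : ℕ)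
    (hg : ∀ k < n, ∀ y ∈ arc (2 ^ k * x) (2 ^ k * δ), κ k ≤ gfun c y) :
    (∏ k ∈ Finset.range n, κ k) * μ.real (arc (2 ^ n * x) (2 ^ n * δ)) ≤ μ.real (arc x δ) := by
  induction n with
  | zero => simp
  | succ n ih =>
    refine le_trans ?_ (ih fun k hk => hg k (hk.trans n.lt_succ_self))
    have h := hμ.mul_measureReal_dbl_image_le (isCompact_arc _ _) (hg n n.lt_succ_self)
    rw [dbl_image_arc, ← mul_assoc, ← mul_assoc, ← pow_succ'] at h
    rw [Finset.prod_range_succ, mul_assoc]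
    exact mul_le_mul_of_nonneg_left h (Finset.prod_nonneg fun k _ => hκ k)

lemma le_abs_sin_pi_mul {x d : ℝ} (h : ∀ m : ℤ, d ≤ |x - m|) : d ≤ |Real.sin (Real.pi * x)| := by
  set u := x - round x with hu
  have hsin : |Real.sin (Real.pi * x)| = |Real.sin (Real.pi * u)| := by
    have : Real.pi * u = Real.pi * x - (round x : ℤ) * Real.pi := by rw [hu]; ring
    rw [this, Real.sin_sub_int_mul_pi, abs_mul, abs_zpow]
    simp
  have hpi := Real.pi_pos
  have hu2 : |u| ≤ 1 / 2 := abs_sub_round x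
  have hle := Real.mul_le_sin (x := Real.pi * |u|) (by positivity) (by nlinarith)
  have habs : |Real.sin (Real.pi * u)| = Real.sin (Real.pi * |u|) := by
    rw [← abs_of_nonneg (a := Real.sin (Real.pi * |u|))
      (Real.sin_nonneg_of_nonneg_of_le_pi (by positivity) (by nlinarith))]
    rcases abs_cases u with ⟨h1, _⟩ | ⟨h1, _⟩ <;> rw [h1]
    rw [mul_neg, Real.sin_neg, abs_neg]
  have : 2 / Real.pi * (Real.pi * |u|) = 2 * |u| := by field_simp
  rw [hsin, habs]
  linarith [h (round x), abs_nonneg u]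

lemma sq_le_gfun {p t d : ℝ} (hd : 0 ≤ d) (h : ∀ m : ℤ, d ≤ |t - p - m|) :
    d ^ 2 ≤ gfun ((p - 1 / 2 : ℝ) : Torus) (t : Torus) := by
  rw [gfun, ← AddCircle.coe_sub, absCos_coe]
  have : Real.pi * (t - (p - 1 / 2)) = Real.pi * (t - p) + Real.pi / 2 := by ring
  rw [this, Real.cos_add_pi_div_two, abs_neg]
  exact pow_le_pow_left₀ hd (le_abs_sin_pi_mul h) 2

/-- Every dyadic interval of level `n` has a subinterval of level `n + r` whose first `n` images
under doubling keep a distance at least their own length from `p + ℤ`. -/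
lemma exists_subinterval_avoiding (p : ℝ) (j : ℤ) {n r : ℕ} (hnr : 3 * n < 2 ^ r) :
    ∃ i : ℕ, i < 2 ^ r ∧ ∀ k < n, ∀ t : ℝ,
      2 ^ k * ((j * 2 ^ r + i) / 2 ^ (n + r)) ≤ t →
      t ≤ 2 ^ k * ((j * 2 ^ r + i) / 2 ^ (n + r)) + 2 ^ k * (1 / 2 ^ (n + r)) →
      ∀ m : ℤ, (1 / 2 : ℝ) ^ (n - k + r) ≤ |t - p - m| := by
  classical
  set bad : Finset ℕ := (Finset.range n ×ˢ ({-1, 0, 1} : Finset ℤ)).image fun q =>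
    ((⌊p * 2 ^ (n - q.1 + r)⌋ + q.2) % 2 ^ r).toNat with hbad
  have hcard : bad.card < (Finset.range (2 ^ r)).card := by
    refine Finset.card_image_le.trans_lt ?_
    rw [Finset.card_product, Finset.card_range, Finset.card_range]
    have : ({-1, 0, 1} : Finset ℤ).card = 3 := rfl
    rw [this]
    omega
  obtain ⟨i, hi, hib⟩ := Finset.exists_mem_notMem_of_card_lt_card hcard
  rw [Finset.mem_range] at hi
  refine ⟨i, hi, fun k hk t ht1 ht2 m => ?_⟩
  by_contra! hlt
  apply hib
  obtain ⟨e, rfl⟩ : ∃ e, n = k + e := ⟨n - k, by omega⟩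
  have hke : k + e - k = e := by omega
  rw [hke, one_div, inv_pow] at hlt
  set N : ℝ := 2 ^ (e + r) with hN
  have hN0 : 0 < N := by positivity
  set a : ℤ := j * 2 ^ r + i with ha
  have hsplit : (2 : ℝ) ^ (k + e + r) = 2 ^ k * N := by rw [hN, ← pow_add, add_assoc]
  have h2k : (0 : ℝ) < 2 ^ k := by positivity
  have hx : (2 : ℝ) ^ k * ((j * 2 ^ r + i) / 2 ^ (k + e + r)) = a / N := by
    rw [hsplit, ha]
    push_cast
    field_simp
  have hδ : (2 : ℝ) ^ k * (1 / 2 ^ (k + e + r)) = 1 / N := by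
    rw [hsplit]
    field_simp
  rw [hx] at ht1
  rw [hx, hδ, ← add_div] at ht2
  rw [div_le_iff₀ hN0] at ht1
  rw [le_div_iff₀ hN0] at ht2
  have hlt' : |(t - p - m) * N| < 1 := by
    rw [abs_mul, abs_of_pos hN0]
    calc |t - p - m| * N < N⁻¹ * N := mul_lt_mul_of_pos_right hlt hN0
      _ = 1 := inv_mul_cancel₀ hN0.ne'
  rw [abs_lt] at hlt'
  have hf1 := Int.floor_le (p * N)
  have hf2 := Int.lt_floor_add_one (p * N)
  set q := ⌊p * N⌋ with hq
  set E : ℤ := a - q - m * 2 ^ (e + r) with hE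
  have hEr : (E : ℝ) = a - q - m * N := by rw [hE, hN]; push_cast; ring
  have hE1 : -2 < E := by
    have : (-2 : ℝ) < E := by rw [hEr]; nlinarith [hlt'.1]
    exact_mod_cast this
  have hE2 : E < 2 := by
    have : (E : ℝ) < 2 := by rw [hEr]; nlinarith [hlt'.2]
    exact_mod_cast this
  rw [hbad, Finset.mem_image]
  refine ⟨(k, E), ?_, ?_⟩
  · rw [Finset.mem_product, Finset.mem_range]
    refine ⟨hk, ?_⟩
    simp only [Finset.mem_insert, Finset.mem_singleton]
    omega
  · simp only [hke]
    rw [← hN, ← hq]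
    have hval : q + E = i + 2 ^ r * (j - m * 2 ^ e) := by
      rw [hE, ha, pow_add]
      ring
    rw [hval, Int.add_mul_emod_self_left, Int.emod_eq_of_lt (by positivity) (by exact_mod_cast hi)]
    simp

lemma exists_wordVal_eq (n : ℕ) (ω : Fin n → Bool) : ∃ j : ℕ, wordVal n ω = j / 2 ^ n := by
  induction n with
  | zero => exact ⟨0, by simp [wordVal]⟩
  | succ n ih =>
    obtain ⟨j, hj⟩ := ih (fun i => ω i.castSucc)
    refine ⟨2 * j + if ω (Fin.last n) then 1 else 0, ?_⟩
    rw [wordVal, Fin.sum_univ_castSucc]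
    simp only [wordVal] at hj
    simp only [Fin.val_castSucc, Fin.val_last, hj]
    push_cast
    rw [pow_succ]
    field_simp

lemma exists_word (n j : ℕ) (hj : j < 2 ^ n) : ∃ ω : Fin n → Bool, wordVal n ω = j / 2 ^ n := by
  induction n generalizing j with
  | zero =>
    obtain rfl : j = 0 := by simpa using hj
    exact ⟨fun _ => false, by simp [wordVal]⟩
  | succ n ih =>
    obtain ⟨ω, hω⟩ := ih (j / 2) (by rw [pow_succ] at hj; omega)
    refine ⟨Fin.snoc (α := fun _ => Bool) ω (decide (j % 2 = 1)), ?_⟩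
    rw [wordVal, Fin.sum_univ_castSucc]
    simp only [wordVal] at hω
    simp only [Fin.val_castSucc, Fin.val_last, Fin.snoc_castSucc, Fin.snoc_last, hω]
    have hjr : (j : ℝ) = 2 * (j / 2 : ℕ) + (j % 2 : ℕ) := by
      exact_mod_cast (Nat.div_add_mod j 2).symm
    rw [hjr, pow_succ]
    rcases Nat.mod_two_eq_zero_or_one j with h | h <;> simp [h] <;> field_simp

/-- The basic recursion: the measure of a level-`n` cylinder is controlled from below by the
measures of cylinders of a much smaller level `r`. -/
lemma IsGMeasure.le_measureReal_cyl {c : Torus} {μ : Measure Torus} (hμ : IsGMeasure c μ)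
    {n r : ℕ} (hnr : 3 * n < 2 ^ r) {v : ℝ} (hv : ∀ η : Fin r → Bool, v ≤ μ.real (cyl r η))
    (ω : Fin n → Bool) : (1 / 2 : ℝ) ^ (n * (n + 1) + 2 * (n * r)) * v ≤ μ.real (cyl n ω) := by
  have := hμ.1
  obtain ⟨c₀, hc₀⟩ := QuotientAddGroup.mk_surjective c
  have hc : c = ((c₀ + 1 / 2 - 1 / 2 : ℝ) : Torus) := by rw [add_sub_cancel_right]; exact hc₀.symm
  obtain ⟨j, hj⟩ := exists_wordVal_eq n ω
  obtain ⟨i, hi, hav⟩ := exists_subinterval_avoiding (c₀ + 1 / 2) (j : ℤ) hnr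
  obtain ⟨η, hη⟩ := exists_word r i hi
  set x : ℝ := (((j : ℤ) : ℝ) * 2 ^ r + i) / 2 ^ (n + r) with hx
  set δ : ℝ := 1 / 2 ^ (n + r) with hδ
  have hsub : arc x δ ⊆ cyl n ω := by
    have hi' : (i : ℝ) + 1 ≤ 2 ^ r := by exact_mod_cast hi
    refine Set.image_mono (Set.Icc_subset_Icc ?_ ?_)
    · rw [hj, hx, pow_add, div_le_div_iff₀ (by positivity) (by positivity)]
      push_cast
      have : (0 : ℝ) ≤ i * 2 ^ n := by positivity
      nlinarith
    · rw [hj, hx, hδ, ← add_div, ← add_div, pow_add,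
        div_le_div_iff₀ (by positivity) (by positivity)]
      push_cast
      have : (0 : ℝ) < 2 ^ n := by positivity
      nlinarith
  have himg : arc (2 ^ n * x) (2 ^ n * δ) = cyl r η := by
    have h1 : (2 : ℝ) ^ n * x = wordVal r η + (j : ℤ) := by
      rw [hη, hx, pow_add]
      field_simp
      ring
    have h2 : (2 : ℝ) ^ n * δ = 1 / 2 ^ r := by
      rw [hδ, pow_add]
      field_simp
    rw [h1, h2, arc_add_intCast]
    rfl
  have hiter := hμ.prod_mul_measureReal_arc_le x δ (fun k => ((1 / 2 : ℝ) ^ (n - k + r)) ^ 2)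
    (fun k => by positivity) n (by
      rintro k hk _ ⟨t, ⟨ht1, ht2⟩, rfl⟩
      rw [hc]
      exact sq_le_gfun (by positivity) (hav k hk t ht1 ht2))
  have hprod : ∏ k ∈ Finset.range n, ((1 / 2 : ℝ) ^ (n - k + r)) ^ 2 =
      (1 / 2 : ℝ) ^ (n * (n + 1) + 2 * (n * r)) := by
    rw [Finset.prod_pow, Finset.prod_pow_eq_pow_sum, ← pow_mul]
    congr 1
    have hrefl := Finset.sum_range_reflect (fun k => k + 1 + r) n
    have hs : ∑ k ∈ Finset.range n, (n - k + r) = ∑ k ∈ Finset.range n, (k + 1 + r) := by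
      rw [← hrefl]
      refine Finset.sum_congr rfl fun k hk => ?_
      rw [Finset.mem_range] at hk
      omega
    rw [hs, Finset.sum_add_distrib, Finset.sum_add_distrib, Finset.sum_const, Finset.sum_const,
      Finset.card_range, smul_eq_mul, smul_eq_mul, mul_one]
    have hg := Finset.sum_range_id_mul_two n
    rcases n with _ | n
    · simp
    · simp only [Nat.add_sub_cancel] at hg
      nlinarith
  rw [hprod, himg] at hiter
  calc _ ≤ (1 / 2 : ℝ) ^ (n * (n + 1) + 2 * (n * r)) * μ.real (cyl r η) :=
        mul_le_mul_of_nonneg_left (hv η) (by positivity)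
    _ ≤ μ.real (arc x δ) := hiter
    _ ≤ μ.real (cyl n ω) := measureReal_mono hsub

lemma eventually_three_mul_lt_two_pow_div :
    ∀ᶠ n : ℕ in atTop, 3 * n < 2 ^ (n / 100) := by
  have h := (isLittleO_pow_const_const_pow_of_one_lt (R := ℝ) 1 (one_lt_two)).def
    (c := 1 / 1000) (by norm_num)
  have hdiv : Tendsto (fun n : ℕ => n / 100) atTop atTop :=
    Nat.tendsto_div_const_atTop (by norm_num)
  filter_upwards [hdiv.eventually h, eventually_ge_atTop 1000] with n hn hn'
  simp only [pow_one, Real.norm_natCast, norm_pow, Real.norm_ofNat] at hn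
  have h1 : ((1000 * (n / 100) : ℕ) : ℝ) ≤ ((2 ^ (n / 100) : ℕ) : ℝ) := by
    push_cast
    linarith
  have h2 : 1000 * (n / 100) ≤ 2 ^ (n / 100) := by exact_mod_cast h1
  omega

lemma IsGMeasure.exists_exp_neg_le_measureReal_cyl {c : Torus} {μ : Measure Torus}
    (hμ : IsGMeasure c μ) (hpos : ∀ (n : ℕ) (ω : Fin n → Bool), 0 < μ (cyl n ω)) :
    ∃ B : ℝ, ∀ (n : ℕ) (ω : Fin n → Bool),
      Real.exp (-(9 / 10 * (n : ℝ) ^ 2 + B)) ≤ μ.real (cyl n ω) := by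
  have := hμ.1
  obtain ⟨n₀, hn₀⟩ := eventually_atTop.1
    (eventually_three_mul_lt_two_pow_div.and (eventually_ge_atTop 100))
  obtain ⟨B, hB⟩ := (((Finset.range n₀).sigma
    fun n => (Finset.univ : Finset (Fin n → Bool))).image
      fun q : (n : ℕ) × (Fin n → Bool) => -Real.log (μ.real (cyl q.1 q.2))).exists_le
  refine ⟨B, fun n => ?_⟩
  induction n using Nat.strong_induction_on with
  | _ n ih =>
    intro ω
    rcases lt_or_ge n n₀ with hn | hn
    · have hmem := hB _ (Finset.mem_image_of_mem _ (Finset.mem_sigma (a := ⟨n, ω⟩) |>.2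
        ⟨Finset.mem_range.2 hn, Finset.mem_univ ω⟩))
      have hμpos : 0 < μ.real (cyl n ω) :=
        ENNReal.toReal_pos (hpos n ω).ne' (measure_ne_top _ _)
      rw [← Real.le_log_iff_exp_le hμpos]
      nlinarith [sq_nonneg (n : ℝ)]
    · obtain ⟨hnr, hn100⟩ := hn₀ n hn
      refine le_trans ?_ (hμ.le_measureReal_cyl hnr (ih _ (by omega)) ω)
      have hn' : (100 : ℝ) ≤ n := by exact_mod_cast hn100
      have hr : ((n / 100 : ℕ) : ℝ) ≤ n / 100 := by
        simpa using (Nat.cast_div_le (α := ℝ) (m := n) (n := 100))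
      have hr0 : (0 : ℝ) ≤ ((n / 100 : ℕ) : ℝ) := Nat.cast_nonneg _
      set r := n / 100
      have hhalf : (1 / 2 : ℝ) = Real.exp (-Real.log 2) := by
        rw [Real.exp_neg, Real.exp_log two_pos, one_div]
      rw [hhalf, ← Real.exp_nat_mul, ← Real.exp_add, Real.exp_le_exp]
      push_cast
      have hexp : (n : ℝ) * (n + 1) + 2 * (n * r) ≤ 103 / 100 * n ^ 2 := by nlinarith
      have hr2 : (r : ℝ) ^ 2 ≤ (n / 100) ^ 2 := pow_le_pow_left₀ hr0 hr 2
      have hlog : Real.log 2 ≤ 7 / 10 := by linarith [Real.log_two_lt_d9]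
      have hmul : ((n : ℝ) * (n + 1) + 2 * (n * r)) * Real.log 2 ≤
          103 / 100 * n ^ 2 * (7 / 10) :=
        mul_le_mul hexp hlog (Real.log_nonneg one_le_two) (by positivity)
      nlinarith [sq_nonneg (n : ℝ)]

/-- for `c ≠ 0` and a fully supported `g`-measure `μ` for `g^c`,
`liminf_n (1/n²) · min_{ω ∈ {0,1}ⁿ} log μ(⟨ω⟩) ≥ −1`. -/
theorem stmt16 (c : Torus) (hc : c ≠ 0) (μ : Measure Torus) (hμ : IsGMeasure c μ)
    (hpos : ∀ (n : ℕ) (ω : Fin n → Bool), 0 < μ (cyl n ω)) :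
    (-1 : EReal) ≤
      atTop.liminf fun n : ℕ =>
        (((((n : ℝ) ^ 2)⁻¹ *
            ⨅ ω : Fin n → Bool, Real.log ((μ (cyl n ω)).toReal)) : ℝ) : EReal) := by
  obtain ⟨B, hB⟩ := hμ.exists_exp_neg_le_measureReal_cyl hpos
  have hprob := hμ.1
  refine le_liminf_of_le (by isBoundedDefault) ?_
  have hlarge : ∀ᶠ n : ℕ in atTop, 10 * B ≤ n := tendsto_natCast_atTop_atTop.eventually_ge_atTop _
  filter_upwards [hlarge, eventually_ge_atTop 1] with n hnB hn
  have hn' : (1 : ℝ) ≤ n := by exact_mod_cast hn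
  have hmin : -(n : ℝ) ^ 2 ≤ ⨅ ω : Fin n → Bool, Real.log ((μ (cyl n ω)).toReal) := by
    refine le_ciInf fun ω => ?_
    have h := (Real.le_log_iff_exp_le
      (ENNReal.toReal_pos (hpos n ω).ne' (measure_ne_top _ _))).2 (hB n ω)
    nlinarith
  have h : (-1 : ℝ) ≤
      ((n : ℝ) ^ 2)⁻¹ * ⨅ ω : Fin n → Bool, Real.log ((μ (cyl n ω)).toReal) := by
    rw [inv_mul_eq_div, le_div_iff₀ (by positivity)]
    linarith
  simpa using EReal.coe_le_coe_iff.2 h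

end GTM
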